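/- Let E be a set and let f, g : 2^E → ℤ be submodular functions (i.e., f(X) + f(Y) ≥ f(X ∪ Y) + f(X ∩ Y) for all X, Y ⊆ E, and likewise for g) such that f − g is order-preserving (i.e., f(X) − g(X) ≤ f(Y) − g(Y) whenever X ⊆ Y ⊆ E). Then the function h defined by h(X) = min{f(X), g(X)} is submodular. -/

import Mathlib

open Set

/-- If `f` and `g` are submodular functions on `E` such that `f - g` is
order-preserving, then `h(X) = min (f X) (g X)` is submodular. -/
theorem submodular_min_of_diff_monotone {α : Type*} (E : Set α) (f g : Set α → ℤ)
    (hf : ∀ X ⊆ E, ∀ Y ⊆ E, f (X ∪ Y) + f (X ∩ Y) ≤ f X + f Y)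
    (hg : ∀ X ⊆ E, ∀ Y ⊆ E, g (X ∪ Y) + g (X ∩ Y) ≤ g X + g Y)
    (hfg : ∀ X Y : Set α, X ⊆ Y → Y ⊆ E → f X - g X ≤ f Y - g Y) :
    ∀ X ⊆ E, ∀ Y ⊆ E,
      min (f (X ∪ Y)) (g (X ∪ Y)) + min (f (X ∩ Y)) (g (X ∩ Y)) ≤
        min (f X) (g X) + min (f Y) (g Y) := by
  intro X hX Y hY
  have h₁ := hf X hX Y hY
  have h₂ := hg X hX Y hY
  have h₃ := hfg (X ∩ Y) X inter_subset_left hX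
  have h₄ := hfg (X ∩ Y) Y inter_subset_right hY
  omega
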